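/- Decomposition of the Landau matrix through the Bessel potential and a weighted pointwise bound (Proposition 3.1, identity (3.5) and bound (3.6)): let w₀ be a Schwartz function on ℝ³ and set w := ⟨·⟩² w₀. Then for every v ∈ ℝ³: A[w₀](v) = A[𝓜w₀](v) − A[Δ(𝓜w₀)](v), and there exists a universal constant C > 0 (independent of w₀) such that for every v ∈ ℝ³: |A[𝓜w₀](v)| ≤ C ⟨v⟩ ‖𝓜w‖_{L²(ℝ³)}, where |·| denotes any fixed matrix norm. -/

import Mathlib

open MeasureTheory Set
open scoped ENNReal

noncomputable section

/-- The Japanese bracket `⟨v⟩ = (1+|v|²)^(1/2)` on `ℝ³`. -/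
def jap (v : EuclideanSpace ℝ (Fin 3)) : ℝ := Real.sqrt (1 + ‖v‖ ^ 2)

/-- Partial derivative in the `i`-th coordinate direction. -/
def pd (i : Fin 3) (φ : EuclideanSpace ℝ (Fin 3) → ℝ) (v : EuclideanSpace ℝ (Fin 3)) : ℝ :=
  fderiv ℝ φ v (EuclideanSpace.single i 1)

/-- Iterated partial derivative along a list of coordinate directions (a multi-index). -/
def pdMany : List (Fin 3) → (EuclideanSpace ℝ (Fin 3) → ℝ) → EuclideanSpace ℝ (Fin 3) → ℝ
  | [], φ => φ
  | i :: l, φ => pd i (pdMany l φ)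

/-- The projection kernel `P(z) = Id − z⊗z/|z|²`. -/
def Pker (z : EuclideanSpace ℝ (Fin 3)) (i j : Fin 3) : ℝ :=
  (if i = j then (1 : ℝ) else 0) - z i * z j / ‖z‖ ^ 2

/-- The Landau matrix `A[h](v) = (1/(8π)) ∫ (P(v−z)/|v−z|) h(z) dz` (entry `(i,j)`). -/
def LandauA (h : EuclideanSpace ℝ (Fin 3) → ℝ) (v : EuclideanSpace ℝ (Fin 3)) (i j : Fin 3) : ℝ :=
  (1 / (8 * Real.pi)) * ∫ z, Pker (v - z) i j / ‖v - z‖ * h z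

/-- The Landau potential `a[h](v) = (1/(4π)) ∫ h(z)/|v−z| dz`. -/
def landaua (h : EuclideanSpace ℝ (Fin 3) → ℝ) (v : EuclideanSpace ℝ (Fin 3)) : ℝ :=
  (1 / (4 * Real.pi)) * ∫ z, h z / ‖v - z‖

/-- The Bessel potential operator `𝓜 = (I − Δ)⁻¹` via its integral kernel. -/
def besselM (h : EuclideanSpace ℝ (Fin 3) → ℝ) (v : EuclideanSpace ℝ (Fin 3)) : ℝ :=
  (1 / (4 * Real.pi)) * ∫ z, Real.exp (-‖v - z‖) / ‖v - z‖ * h z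

/-- Squared euclidean norm of the gradient. -/
def gradNormSq (φ : EuclideanSpace ℝ (Fin 3) → ℝ) (v : EuclideanSpace ℝ (Fin 3)) : ℝ :=
  ∑ i, (pd i φ v) ^ 2

/-- Euclidean norm of the gradient. -/
def gradNorm (φ : EuclideanSpace ℝ (Fin 3) → ℝ) (v : EuclideanSpace ℝ (Fin 3)) : ℝ :=
  Real.sqrt (gradNormSq φ v)



/-- Euclidean three-space. -/
abbrev E3 := EuclideanSpace ℝ (Fin 3)

/-- Continuous bounded functions. -/
structure CB0 (f : E3 → ℝ) : Prop where
  cont : Continuous f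
  bdd : ∃ C, ∀ x, |f x| ≤ C

/-- Differentiable functions, bounded and with continuous bounded partial derivatives. -/
structure CB1 (f : E3 → ℝ) : Prop where
  diff : Differentiable ℝ f
  cb : CB0 f
  pd : ∀ m, CB0 (pd m f)

/-- The same with two derivatives. -/
structure CB2 (f : E3 → ℝ) : Prop where
  cb : CB1 f
  pd : ∀ m, CB1 (pd m f)

lemma CB0.mul {f g : E3 → ℝ} (hf : CB0 f) (hg : CB0 g) : CB0 (fun x => f x * g x) := by
  obtain ⟨C, hC⟩ := hf.bdd
  obtain ⟨D, hD⟩ := hg.bdd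
  refine ⟨hf.cont.mul hg.cont, C * D, fun x => ?_⟩
  rw [abs_mul]
  exact mul_le_mul (hC x) (hD x) (abs_nonneg _) ((abs_nonneg _).trans (hC x))

lemma CB0.add {f g : E3 → ℝ} (hf : CB0 f) (hg : CB0 g) : CB0 (fun x => f x + g x) := by
  obtain ⟨C, hC⟩ := hf.bdd
  obtain ⟨D, hD⟩ := hg.bdd
  exact ⟨hf.cont.add hg.cont, C + D, fun x => (abs_add_le _ _).trans (add_le_add (hC x) (hD x))⟩

lemma CB0.neg {f : E3 → ℝ} (hf : CB0 f) : CB0 (fun x => - f x) := by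
  obtain ⟨C, hC⟩ := hf.bdd
  exact ⟨hf.cont.neg, C, fun x => by rw [abs_neg]; exact hC x⟩

lemma CB0.sub {f g : E3 → ℝ} (hf : CB0 f) (hg : CB0 g) : CB0 (fun x => f x - g x) := by
  simpa [sub_eq_add_neg] using hf.add hg.neg

lemma CB0.const_mul {f : E3 → ℝ} (hf : CB0 f) (c : ℝ) : CB0 (fun x => c * f x) := by
  obtain ⟨C, hC⟩ := hf.bdd
  exact ⟨hf.cont.const_mul c, |c| * C, fun x => by rw [abs_mul]; gcongr; exact hC x⟩

lemma CB0.sum {f : Fin 3 → E3 → ℝ} (hf : ∀ m, CB0 (f m)) : CB0 (fun x => ∑ m, f m x) := by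
  simp only [Fin.sum_univ_three]
  exact ((hf 0).add (hf 1)).add (hf 2)

lemma CB0.refl {f : E3 → ℝ} (hf : CB0 f) (v : E3) : CB0 (fun y => f (v - y)) := by
  obtain ⟨C, hC⟩ := hf.bdd
  exact ⟨hf.cont.comp (by fun_prop), C, fun x => hC _⟩

lemma pd_mul {f g : E3 → ℝ} (hf : Differentiable ℝ f) (hg : Differentiable ℝ g) (m : Fin 3) :
    pd m (fun x => f x * g x) = fun x => f x * pd m g x + g x * pd m f x := by
  funext x
  simp only [pd]
  rw [fderiv_fun_mul (hf x) (hg x)]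
  simp

lemma pd_add {f g : E3 → ℝ} (hf : Differentiable ℝ f) (hg : Differentiable ℝ g) (m : Fin 3) :
    pd m (fun x => f x + g x) = fun x => pd m f x + pd m g x := by
  funext x
  simp only [pd]
  rw [fderiv_fun_add (hf x) (hg x)]
  simp

lemma pd_neg {f : E3 → ℝ} (m : Fin 3) :
    pd m (fun x => - f x) = fun x => - pd m f x := by
  funext x
  simp only [pd]
  rw [fderiv_fun_neg]
  simp

lemma pd_refl {f : E3 → ℝ} (hf : Differentiable ℝ f) (v : E3) (m : Fin 3) :
    pd m (fun y => f (v - y)) = fun y => - pd m f (v - y) := by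
  funext x
  simp only [pd]
  have h1 : HasFDerivAt (fun y : E3 => v - y) (-ContinuousLinearMap.id ℝ E3) x :=
    (hasFDerivAt_id x).const_sub v
  have h2 := (hf (v - x)).hasFDerivAt.comp x h1
  have h3 : fderiv ℝ (fun y => f (v - y)) x = _ := h2.fderiv
  rw [h3]
  simp

lemma CB1.mul {f g : E3 → ℝ} (hf : CB1 f) (hg : CB1 g) : CB1 (fun x => f x * g x) := by
  refine ⟨hf.diff.mul hg.diff, hf.cb.mul hg.cb, fun m => ?_⟩
  rw [pd_mul hf.diff hg.diff]
  exact (hf.cb.mul (hg.pd m)).add (hg.cb.mul (hf.pd m))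

lemma CB1.add {f g : E3 → ℝ} (hf : CB1 f) (hg : CB1 g) : CB1 (fun x => f x + g x) := by
  refine ⟨hf.diff.add hg.diff, hf.cb.add hg.cb, fun m => ?_⟩
  rw [pd_add hf.diff hg.diff]
  exact (hf.pd m).add (hg.pd m)

lemma CB1.neg {f : E3 → ℝ} (hf : CB1 f) : CB1 (fun x => - f x) := by
  refine ⟨hf.diff.neg, hf.cb.neg, fun m => ?_⟩
  rw [pd_neg]
  exact (hf.pd m).neg

lemma CB1.refl {f : E3 → ℝ} (hf : CB1 f) (v : E3) : CB1 (fun y => f (v - y)) := by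
  refine ⟨hf.diff.comp (by fun_prop), hf.cb.refl v, fun m => ?_⟩
  rw [pd_refl hf.diff]
  exact ((hf.pd m).refl v).neg

lemma CB2.mul {f g : E3 → ℝ} (hf : CB2 f) (hg : CB2 g) : CB2 (fun x => f x * g x) := by
  refine ⟨hf.cb.mul hg.cb, fun m => ?_⟩
  rw [pd_mul hf.cb.diff hg.cb.diff]
  exact (hf.cb.mul (hg.pd m)).add (hg.cb.mul (hf.pd m))

lemma CB2.refl {f : E3 → ℝ} (hf : CB2 f) (v : E3) : CB2 (fun y => f (v - y)) := by
  refine ⟨hf.cb.refl v, fun m => ?_⟩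
  rw [pd_refl hf.cb.diff]
  exact ((hf.pd m).refl v).neg

lemma pd_pd_refl {f : E3 → ℝ} (hf : CB2 f) (v : E3) (m : Fin 3) :
    pd m (pd m (fun y => f (v - y))) = fun y => pd m (pd m f) (v - y) := by
  rw [pd_refl hf.cb.diff, pd_neg, pd_refl (hf.pd m).diff]
  simp

lemma pd_pd_mul {f g : E3 → ℝ} (hf : CB2 f) (hg : CB2 g) (m : Fin 3) :
    pd m (pd m (fun x => f x * g x)) =
      fun x => f x * pd m (pd m g) x + 2 * (pd m f x * pd m g x) + g x * pd m (pd m f) x := by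
  rw [pd_mul hf.cb.diff hg.cb.diff,
    pd_add (hf.cb.diff.fun_mul (hg.pd m).diff) (hg.cb.diff.fun_mul (hf.pd m).diff),
    pd_mul hf.cb.diff (hg.pd m).diff, pd_mul hg.cb.diff (hf.pd m).diff]
  funext x
  ring

lemma norm_fderiv_le_sum (f : E3 → ℝ) (x : E3) : ‖fderiv ℝ f x‖ ≤ ∑ m, |pd m f x| := by
  refine ContinuousLinearMap.opNorm_le_bound _ (by positivity) fun y => ?_
  have hy : y = ∑ m, y m • (EuclideanSpace.single m (1 : ℝ) : E3) := by
    ext i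
    simp [Finset.sum_apply, Pi.single_apply]
  conv_lhs => rw [hy]
  rw [map_sum, Finset.sum_mul]
  refine (norm_sum_le _ _).trans (Finset.sum_le_sum fun m _ => ?_)
  rw [map_smul, norm_smul, mul_comm]
  exact mul_le_mul_of_nonneg_left (PiLp.norm_apply_le y m) (abs_nonneg _)

lemma CB0.schwartz (f : SchwartzMap E3 ℝ) : CB0 f :=
  ⟨f.continuous, _, fun x => f.norm_le_seminorm ℝ x⟩

lemma pd_schwartz (f : SchwartzMap E3 ℝ) (m : Fin 3) :
    ∃ g : SchwartzMap E3 ℝ, pd m f = g :=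
  ⟨SchwartzMap.evalCLM ℝ E3 ℝ (EuclideanSpace.single m 1) (SchwartzMap.fderivCLM ℝ E3 ℝ f), by
    funext x; simp [pd]⟩

lemma CB1.schwartz (f : SchwartzMap E3 ℝ) : CB1 f := by
  refine ⟨f.differentiable, CB0.schwartz f, fun m => ?_⟩
  obtain ⟨g, hg⟩ := pd_schwartz f m
  rw [hg]; exact CB0.schwartz g

lemma CB2.schwartz (f : SchwartzMap E3 ℝ) : CB2 f := by
  refine ⟨CB1.schwartz f, fun m => ?_⟩
  obtain ⟨g, hg⟩ := pd_schwartz f m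
  rw [hg]; exact CB1.schwartz g



/-- Regularized distance to the origin. -/
def rho (ε : ℝ) (y : E3) : ℝ := Real.sqrt (‖y‖ ^ 2 + ε ^ 2)

/-- Regularized Yukawa kernel. -/
def Gk (ε : ℝ) (y : E3) : ℝ := Real.exp (-rho ε y) / rho ε y

/-- Radial part of the gradient of the regularized kernel. -/
def Qk (ε : ℝ) (y : E3) : ℝ :=
  -(Real.exp (-rho ε y) * (1 / rho ε y ^ 2 + 1 / rho ε y ^ 3))

/-- Integrable majorant. -/
def Hk (y : E3) : ℝ := Real.exp (-‖y‖) * (1 / ‖y‖ + 1 / ‖y‖ ^ 2)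

lemma rho_pos {ε : ℝ} (hε : 0 < ε) (y : E3) : 0 < rho ε y := Real.sqrt_pos.2 (by positivity)

lemma rho_sq (ε : ℝ) (y : E3) : rho ε y ^ 2 = ‖y‖ ^ 2 + ε ^ 2 := Real.sq_sqrt (by positivity)

lemma norm_le_rho (ε : ℝ) (y : E3) : ‖y‖ ≤ rho ε y :=
  Real.le_sqrt_of_sq_le (by nlinarith [sq_nonneg ε])

lemma eps_le_rho {ε : ℝ} (y : E3) : ε ≤ rho ε y :=
  Real.le_sqrt_of_sq_le (by nlinarith [sq_nonneg ‖y‖])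

lemma rho_zero (y : E3) : rho 0 y = ‖y‖ := by simp [rho]

lemma hasFDerivAt_rho {ε : ℝ} (hε : 0 < ε) (y : E3) :
    HasFDerivAt (rho ε) ((1 / rho ε y) • innerSL ℝ y) y := by
  have h1 : HasFDerivAt (fun y : E3 => ‖y‖ ^ 2 + ε ^ 2) (2 • innerSL ℝ y) y :=
    ((hasStrictFDerivAt_norm_sq y).hasFDerivAt).add_const _
  have h2 := h1.sqrt (by positivity)
  refine HasFDerivAt.congr_fderiv (f := rho ε) h2 ?_
  rw [← Nat.cast_smul_eq_nsmul ℝ, smul_smul]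
  congr 1
  have := rho_pos hε y
  change _ = 1 / Real.sqrt _
  push_cast
  field_simp

lemma hasFDerivAt_comp_rho {ε : ℝ} (hε : 0 < ε) (y : E3) {F : ℝ → ℝ} {F' : ℝ}
    (hF : HasDerivAt F F' (rho ε y)) :
    HasFDerivAt (fun y => F (rho ε y)) ((F' / rho ε y) • innerSL ℝ y) y := by
  have h := hF.comp_hasFDerivAt y (hasFDerivAt_rho hε y)
  refine HasFDerivAt.congr_fderiv (f := fun y => F (rho ε y)) h ?_
  rw [smul_smul]
  congr 1
  ring

lemma pd_of_hasFDerivAt {f : E3 → ℝ} {c : ℝ} {y : E3}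
    (h : HasFDerivAt f (c • innerSL ℝ y) y) (m : Fin 3) : pd m f y = y m * c := by
  rw [pd, h.fderiv]
  simp [EuclideanSpace.inner_single_right, mul_comm]

lemma hasFDerivAt_Gk {ε : ℝ} (hε : 0 < ε) (y : E3) :
    HasFDerivAt (Gk ε) (Qk ε y • innerSL ℝ y) y := by
  have hr := rho_pos hε y
  have h1 : HasDerivAt (fun r : ℝ => Real.exp (-r) / r)
      ((Real.exp (-rho ε y) * (-1) * rho ε y - Real.exp (-rho ε y) * 1) / rho ε y ^ 2)
      (rho ε y) :=
    ((hasDerivAt_neg _).exp).fun_div (hasDerivAt_id _) hr.ne'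
  refine HasFDerivAt.congr_fderiv (f := Gk ε) (hasFDerivAt_comp_rho hε y h1) ?_
  congr 1
  rw [Qk]
  field_simp
  ring

lemma hasFDerivAt_Qk {ε : ℝ} (hε : 0 < ε) (y : E3) :
    HasFDerivAt (Qk ε) ((Real.exp (-rho ε y) *
      (1 / rho ε y ^ 3 + 3 / rho ε y ^ 4 + 3 / rho ε y ^ 5)) • innerSL ℝ y) y := by
  have hr := rho_pos hε y
  have h1 := (((hasDerivAt_neg (rho ε y)).exp).fun_mul
    ((((hasDerivAt_pow 2 (rho ε y)).fun_inv (by positivity))).fun_add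
     ((((hasDerivAt_pow 3 (rho ε y)).fun_inv (by positivity)))))).fun_neg
  have h2 := hasFDerivAt_comp_rho hε y h1
  have h3 : Qk ε = (fun y => -(Real.exp (-rho ε y) * ((rho ε y ^ 2)⁻¹ + (rho ε y ^ 3)⁻¹))) := by
    funext y; simp [Qk]
  rw [h3]
  refine HasFDerivAt.congr_fderiv h2 ?_
  congr 1
  push_cast
  field_simp
  ring

lemma pd_Gk {ε : ℝ} (hε : 0 < ε) (m : Fin 3) : pd m (Gk ε) = fun y => y m * Qk ε y := by
  funext y
  exact pd_of_hasFDerivAt (hasFDerivAt_Gk hε y) m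

lemma diff_Gk {ε : ℝ} (hε : 0 < ε) : Differentiable ℝ (Gk ε) :=
  fun y => (hasFDerivAt_Gk hε y).differentiableAt

lemma diff_Qk {ε : ℝ} (hε : 0 < ε) : Differentiable ℝ (Qk ε) :=
  fun y => (hasFDerivAt_Qk hε y).differentiableAt

lemma diff_coord (m : Fin 3) : Differentiable ℝ (fun y : E3 => y m) := by fun_prop

lemma pd_coord (m : Fin 3) : pd m (fun y : E3 => y m) = fun _ => 1 := by
  funext y
  have h : HasFDerivAt (fun y : E3 => y m) (EuclideanSpace.proj m : E3 →L[ℝ] ℝ) y :=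
    (EuclideanSpace.proj m : E3 →L[ℝ] ℝ).hasFDerivAt
  rw [pd, h.fderiv]
  simp

lemma diff_pd_Gk {ε : ℝ} (hε : 0 < ε) (m : Fin 3) : Differentiable ℝ (pd m (Gk ε)) := by
  rw [pd_Gk hε]
  exact (diff_coord m).fun_mul (diff_Qk hε)

lemma pd_pd_Gk {ε : ℝ} (hε : 0 < ε) (m : Fin 3) : pd m (pd m (Gk ε)) = fun y =>
    Real.exp (-rho ε y) * (y m ^ 2 * (1 / rho ε y ^ 3 + 3 / rho ε y ^ 4 + 3 / rho ε y ^ 5)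
      - (1 / rho ε y ^ 2 + 1 / rho ε y ^ 3)) := by
  rw [pd_Gk hε, pd_mul (diff_coord m) (diff_Qk hε), pd_coord]
  funext y
  rw [pd_of_hasFDerivAt (hasFDerivAt_Qk hε y) m, Qk]
  ring

lemma lap_Gk {ε : ℝ} (hε : 0 < ε) (y : E3) : Gk ε y - ∑ m, pd m (pd m (Gk ε)) y =
    ε ^ 2 * Real.exp (-rho ε y) * (1 / rho ε y ^ 3 + 3 / rho ε y ^ 4 + 3 / rho ε y ^ 5) := by
  have hr := rho_pos hε y
  have h2 := rho_sq ε y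
  rw [EuclideanSpace.norm_sq_eq] at h2
  simp only [pd_pd_Gk hε, Gk, Fin.sum_univ_three, Real.norm_eq_abs, sq_abs] at *
  have h3 : ε ^ 2 = rho ε y ^ 2 - (y 0 ^ 2 + y 1 ^ 2 + y 2 ^ 2) := by linarith
  rw [h3]
  field_simp
  ring

lemma abs_coord_le (y : E3) (m : Fin 3) : |y m| ≤ ‖y‖ := PiLp.norm_apply_le y m

lemma Hk_nonneg (y : E3) : 0 ≤ Hk y := by unfold Hk; positivity

lemma exp_rho_le_Hk (ε : ℝ) {y : E3} (hy : y ≠ 0) :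
    Real.exp (-rho ε y) * (1 / rho ε y + 1 / rho ε y ^ 2) ≤ Hk y := by
  have h0 : 0 < ‖y‖ := norm_pos_iff.2 hy
  have h1 := norm_le_rho ε y
  have h2 : 0 < rho ε y := h0.trans_le h1
  unfold Hk
  gcongr

lemma abs_Gk_le (ε : ℝ) {y : E3} (hy : y ≠ 0) : |Gk ε y| ≤ Hk y := by
  have hr : 0 < rho ε y := (norm_pos_iff.2 hy).trans_le (norm_le_rho ε y)
  refine le_trans ?_ (exp_rho_le_Hk ε hy)
  rw [Gk, abs_of_pos (by positivity), mul_add]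
  have : 0 ≤ Real.exp (-rho ε y) * (1 / rho ε y ^ 2) := by positivity
  rw [div_eq_mul_one_div]
  linarith

lemma abs_coord_Qk_le (ε : ℝ) {y : E3} (hy : y ≠ 0) (m : Fin 3) : |y m * Qk ε y| ≤ Hk y := by
  have hr : 0 < rho ε y := (norm_pos_iff.2 hy).trans_le (norm_le_rho ε y)
  refine le_trans ?_ (exp_rho_le_Hk ε hy)
  rw [abs_mul, Qk, abs_neg, abs_of_pos (a := Real.exp _ * _) (by positivity)]
  calc |y m| * (Real.exp (-rho ε y) * (1 / rho ε y ^ 2 + 1 / rho ε y ^ 3))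
      ≤ rho ε y * (Real.exp (-rho ε y) * (1 / rho ε y ^ 2 + 1 / rho ε y ^ 3)) := by
        gcongr
        exact (abs_coord_le y m).trans (norm_le_rho ε y)
    _ = _ := by field_simp

lemma abs_pd_pd_Gk_le {ε : ℝ} (hε : 0 < ε) {y : E3} (hy : y ≠ 0) (m : Fin 3) :
    |pd m (pd m (Gk ε)) y| ≤ (4 + 4 / ε) * Hk y := by
  have hr := rho_pos hε y
  have hH := exp_rho_le_Hk ε hy
  have h3 : 1 / rho ε y ^ 3 ≤ (1 / ε) * (1 / rho ε y ^ 2) := by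
    rw [div_mul_div_comm, one_mul]
    apply one_div_le_one_div_of_le (by positivity)
    rw [pow_succ' _ 2]
    gcongr
    exact eps_le_rho y
  have hm : y m ^ 2 ≤ rho ε y ^ 2 := by
    rw [← sq_abs]
    gcongr
    exact (abs_coord_le y m).trans (norm_le_rho ε y)
  have hm2 : y m ^ 2 * (1 / rho ε y ^ 3 + 3 / rho ε y ^ 4 + 3 / rho ε y ^ 5) ≤
      1 / rho ε y + 3 / rho ε y ^ 2 + 3 / rho ε y ^ 3 := by
    calc _ ≤ rho ε y ^ 2 * (1 / rho ε y ^ 3 + 3 / rho ε y ^ 4 + 3 / rho ε y ^ 5) := by gcongr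
      _ = _ := by field_simp
  have hm0 : 0 ≤ y m ^ 2 * (1 / rho ε y ^ 3 + 3 / rho ε y ^ 4 + 3 / rho ε y ^ 5) := by positivity
  simp only [pd_pd_Gk hε]
  rw [abs_mul, abs_of_pos (Real.exp_pos _)]
  have hb : |y m ^ 2 * (1 / rho ε y ^ 3 + 3 / rho ε y ^ 4 + 3 / rho ε y ^ 5)
      - (1 / rho ε y ^ 2 + 1 / rho ε y ^ 3)| ≤ (4 + 4 / ε) * (1 / rho ε y + 1 / rho ε y ^ 2) := by
    have p1 : 0 < 1 / rho ε y := by positivity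
    have p2 : 0 < 1 / rho ε y ^ 2 := by positivity
    have p3 : 0 < 1 / rho ε y ^ 3 := by positivity
    have p4 : 0 < 1 / ε * (1 / rho ε y) := by positivity
    have e1 : 3 / rho ε y ^ 2 = 3 * (1 / rho ε y ^ 2) := by ring
    have e2 : 3 / rho ε y ^ 3 = 3 * (1 / rho ε y ^ 3) := by ring
    have e3 : (4 + 4 / ε) * (1 / rho ε y + 1 / rho ε y ^ 2) = 4 * (1 / rho ε y) +
      4 * (1 / rho ε y ^ 2) + 4 * (1 / ε * (1 / rho ε y)) + 4 * (1 / ε * (1 / rho ε y ^ 2)) := by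
      ring
    rw [e3, abs_le]
    constructor <;> linarith
  calc _ ≤ Real.exp (-rho ε y) * ((4 + 4 / ε) * (1 / rho ε y + 1 / rho ε y ^ 2)) := by gcongr
    _ = (4 + 4 / ε) * (Real.exp (-rho ε y) * (1 / rho ε y + 1 / rho ε y ^ 2)) := by ring
    _ ≤ _ := by gcongr

lemma measurable_rho (ε : ℝ) : Measurable (rho ε) := by unfold rho; fun_prop
lemma measurable_Gk (ε : ℝ) : Measurable (Gk ε) := by
  have := measurable_rho ε
  unfold Gk; fun_prop
lemma measurable_Qk (ε : ℝ) : Measurable (Qk ε) := by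
  have := measurable_rho ε
  unfold Qk; fun_prop
lemma measurable_Hk : Measurable Hk := by unfold Hk; fun_prop

lemma finrank_E3 : Module.finrank ℝ E3 = 3 := by simp

lemma integrable_Hk : Integrable Hk := by
  have h : Integrable (fun x : E3 => (fun r : ℝ => Real.exp (-r) * (1 / r + 1 / r ^ 2)) ‖x‖) := by
    refine (integrable_fun_norm_addHaar (f := fun r : ℝ => Real.exp (-r) * (1 / r + 1 / r ^ 2))
      (volume : Measure E3)).2 ?_
    rw [finrank_E3]
    have h1 := Real.GammaIntegral_convergent (s := 2) (by norm_num)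
    have h2 := Real.GammaIntegral_convergent (s := 1) (by norm_num)
    refine (h1.add h2).congr_fun (fun r hr => ?_) measurableSet_Ioi
    have hr' : (0 : ℝ) < r := hr
    simp only [Pi.add_apply, smul_eq_mul]
    norm_num
    field_simp
  exact h

lemma integral_sigma5 : Integrable (fun x : E3 => 1 / rho 1 x ^ 5) ∧
    ∫ x : E3, 1 / rho 1 x ^ 5 = 4 * Real.pi / 3 := by
  obtain ⟨f, hf⟩ : ∃ f : ℝ → ℝ, ∀ r, f r = 1 / Real.sqrt (r ^ 2 + 1 ^ 2) ^ 5 := ⟨_, fun _ => rfl⟩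
  have hfun : (fun x : E3 => 1 / rho 1 x ^ 5) = fun x => f ‖x‖ := by
    funext x; simp [hf, rho]
  have hd : ∀ x ∈ Ici (0 : ℝ), HasDerivAt (fun r : ℝ => r ^ 3 / 3 / Real.sqrt (r ^ 2 + 1 ^ 2) ^ 3)
      (x ^ (3 - 1) • f x) x := by
    intro x _
    have hp : 0 < x ^ 2 + 1 ^ 2 := by positivity
    have hs : 0 < Real.sqrt (x ^ 2 + 1 ^ 2) := Real.sqrt_pos.2 hp
    have hsq : Real.sqrt (x ^ 2 + 1 ^ 2) ^ 2 = x ^ 2 + 1 ^ 2 := Real.sq_sqrt hp.le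
    have h1 := (((hasDerivAt_pow 2 x).add_const ((1 : ℝ) ^ 2)).sqrt hp.ne').fun_pow 3
    have h2 := ((hasDerivAt_pow 3 x).div_const 3).fun_div h1 (by positivity)
    refine h2.congr_deriv ?_
    rw [hf, smul_eq_mul]
    set s := Real.sqrt (x ^ 2 + 1 ^ 2)
    have h4 : x ^ 2 + 1 ^ 2 = s ^ 2 := hsq.symm
    have h5 : x ^ 2 = s ^ 2 - 1 := by rw [hsq]; ring
    norm_num
    field_simp
    linear_combination (-x ^ 2) * h5
  have ht : Filter.Tendsto (fun r : ℝ => r ^ 3 / 3 / Real.sqrt (r ^ 2 + 1 ^ 2) ^ 3) Filter.atTop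
      (nhds (1 / 3)) := by
    have hc : Continuous (fun t : ℝ => 1 / 3 / Real.sqrt (1 + t ^ 2) ^ 3) := by
      refine continuous_const.div (by fun_prop) fun t => ?_
      have : 0 < Real.sqrt (1 + t ^ 2) := Real.sqrt_pos.2 (by positivity)
      positivity
    have h := (hc.tendsto 0).comp tendsto_inv_atTop_zero
    have h0 : (1 : ℝ) / 3 / Real.sqrt (1 + 0 ^ 2) ^ 3 = 1 / 3 := by norm_num
    rw [h0] at h
    refine h.congr' ?_
    filter_upwards [Filter.eventually_gt_atTop 0] with r hr
    have h1 : r ^ 2 + 1 ^ 2 = r ^ 2 * (1 + r⁻¹ ^ 2) := by field_simp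
    rw [h1, Real.sqrt_mul (by positivity), Real.sqrt_sq hr.le]
    have : 0 < Real.sqrt (1 + r⁻¹ ^ 2) := Real.sqrt_pos.2 (by positivity)
    simp only [Function.comp]
    field_simp
  have hi : IntegrableOn (fun x : ℝ => x ^ (3 - 1) • f x) (Ioi 0) := by
    refine integrableOn_Ioi_deriv_of_nonneg' hd ?_ ht
    intro x _
    have : 0 ≤ f x := by rw [hf]; positivity
    exact smul_nonneg (sq_nonneg x) this
  constructor
  · rw [hfun, integrable_fun_norm_addHaar, finrank_E3]
    exact hi
  · rw [hfun, integral_fun_norm_addHaar, finrank_E3, integral_Ioi_of_hasDerivAt_of_tendsto' hd hi ht]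
    simp [Measure.real, EuclideanSpace.volume_ball_fin_three]
    have h : (Real.pi * 4 / 3) ≥ 0 := by positivity
    rw [ENNReal.toReal_ofReal h]
    ring



lemma ae_ne_zero : ∀ᵐ y : E3, y ≠ 0 := compl_mem_ae_iff.2 (measure_singleton 0)

lemma integrable_ker_mul {k f : E3 → ℝ} {c : ℝ} (hk : Measurable k)
    (hb : ∀ y, y ≠ 0 → |k y| ≤ c * Hk y) (hf : CB0 f) : Integrable (fun y => k y * f y) := by
  obtain ⟨C, hC⟩ := hf.bdd
  refine (integrable_Hk.const_mul (c * C)).mono'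
    (hk.mul hf.cont.measurable).aestronglyMeasurable ?_
  filter_upwards [ae_ne_zero] with y hy
  rw [Real.norm_eq_abs, abs_mul]
  calc |k y| * |f y| ≤ (c * Hk y) * C :=
        mul_le_mul (hb y hy) (hC y) (abs_nonneg _) ((abs_nonneg _).trans (hb y hy))
    _ = c * C * Hk y := by ring

lemma tendsto_ker_mul {k : ℝ → E3 → ℝ} {f : E3 → ℝ} (hk : ∀ ε, Measurable (k ε))
    (hb : ∀ ε y, y ≠ 0 → |k ε y| ≤ Hk y)
    (hc : ∀ y, y ≠ 0 → Continuous (fun ε => k ε y)) (hf : CB0 f) :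
    Filter.Tendsto (fun ε => ∫ y, k ε y * f y) (nhdsWithin 0 (Ioi 0)) (nhds (∫ y, k 0 y * f y)) := by
  obtain ⟨C, hC⟩ := hf.bdd
  refine tendsto_integral_filter_of_dominated_convergence (fun y => C * Hk y)
    (Filter.Eventually.of_forall fun ε => ((hk ε).mul hf.cont.measurable).aestronglyMeasurable)
    (Filter.Eventually.of_forall fun ε => ?_) (integrable_Hk.const_mul C) ?_
  · filter_upwards [ae_ne_zero] with y hy
    rw [Real.norm_eq_abs, abs_mul, mul_comm]
    exact mul_le_mul (hC y) (hb ε y hy) (abs_nonneg _) ((abs_nonneg _).trans (hC y))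
  · filter_upwards [ae_ne_zero] with y hy
    exact (((hc y hy).mul continuous_const).tendsto 0).mono_left nhdsWithin_le_nhds

lemma rho_pos' (ε : ℝ) {y : E3} (hy : y ≠ 0) : 0 < rho ε y :=
  (norm_pos_iff.2 hy).trans_le (norm_le_rho ε y)

lemma continuous_rho_eps (y : E3) : Continuous (fun ε => rho ε y) := by unfold rho; fun_prop

lemma continuous_Gk_eps {y : E3} (hy : y ≠ 0) : Continuous (fun ε => Gk ε y) := by
  have := continuous_rho_eps y
  unfold Gk
  exact (Real.continuous_exp.comp this.neg).div this fun ε => (rho_pos' ε hy).ne'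

lemma continuous_Qk_eps {y : E3} (hy : y ≠ 0) : Continuous (fun ε => Qk ε y) := by
  have := continuous_rho_eps y
  unfold Qk
  refine ((Real.continuous_exp.comp this.neg).mul ((continuous_const.div (this.pow 2) fun ε => ?_).add
    (continuous_const.div (this.pow 3) fun ε => ?_))).neg
  · exact pow_ne_zero _ (rho_pos' ε hy).ne'
  · exact pow_ne_zero _ (rho_pos' ε hy).ne'

lemma abs_Gk_le' (ε : ℝ) (y : E3) (hy : y ≠ 0) : |Gk ε y| ≤ 1 * Hk y := by
  rw [one_mul]; exact abs_Gk_le ε hy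

lemma measurable_cQk (ε : ℝ) (m : Fin 3) : Measurable (fun y : E3 => y m * Qk ε y) := by
  have := measurable_Qk ε
  fun_prop

lemma ibp1 {ε : ℝ} (hε : 0 < ε) {h : E3 → ℝ} (hh : CB1 h) (m : Fin 3) :
    ∫ y, Gk ε y * pd m h y = - ∫ y, (y m * Qk ε y) * h y := by
  have e : ∀ y, y m * Qk ε y = fderiv ℝ (Gk ε) y (EuclideanSpace.single m 1) := by
    intro y
    exact (congrFun (pd_Gk hε m) y).symm
  have i1 : Integrable (fun y => (y m * Qk ε y) * h y) :=
    integrable_ker_mul (c := 1) (measurable_cQk ε m)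
      (fun y hy => by rw [one_mul]; exact abs_coord_Qk_le ε hy m) hh.cb
  have i2 := integrable_ker_mul (measurable_Gk ε) (abs_Gk_le' ε) (hh.pd m)
  have i3 := integrable_ker_mul (measurable_Gk ε) (abs_Gk_le' ε) hh.cb
  simp only [e] at i1 ⊢
  exact integral_mul_fderiv_eq_neg_fderiv_mul_of_integrable i1 i2 i3
    (fun x _ => diff_Gk hε x) (fun x _ => hh.diff x)

lemma ibp2 {ε : ℝ} (hε : 0 < ε) {h : E3 → ℝ} (hh : CB1 h) (m : Fin 3) :
    ∫ y, (y m * Qk ε y) * pd m h y = - ∫ y, pd m (pd m (Gk ε)) y * h y := by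
  have i1 : Integrable (fun y => pd m (pd m (Gk ε)) y * h y) := by
    refine integrable_ker_mul (c := 4 + 4 / ε) ?_ (fun y hy => abs_pd_pd_Gk_le hε hy m) hh.cb
    exact measurable_fderiv_apply_const ℝ _ _
  have i2 : Integrable (fun y => (y m * Qk ε y) * pd m h y) :=
    integrable_ker_mul (c := 1) (measurable_cQk ε m)
      (fun y hy => by rw [one_mul]; exact abs_coord_Qk_le ε hy m) (hh.pd m)
  have i3 : Integrable (fun y => (y m * Qk ε y) * h y) :=
    integrable_ker_mul (c := 1) (measurable_cQk ε m)
      (fun y hy => by rw [one_mul]; exact abs_coord_Qk_le ε hy m) hh.cb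
  have e := pd_Gk hε m
  have hd := diff_pd_Gk hε m
  rw [e] at i1 hd ⊢
  exact integral_mul_fderiv_eq_neg_fderiv_mul_of_integrable i1 i2 i3
    (fun x _ => hd x) (fun x _ => hh.diff x)

lemma L1 {h : E3 → ℝ} (hh : CB1 h) (m : Fin 3) :
    ∫ y, Gk 0 y * pd m h y = - ∫ y, (y m * Qk 0 y) * h y := by
  have t1 := tendsto_ker_mul (k := Gk) measurable_Gk (fun ε y hy => abs_Gk_le ε hy)
    (fun y hy => continuous_Gk_eps hy) (hh.pd m)
  have t2 := tendsto_ker_mul (k := fun ε y => y m * Qk ε y) (fun ε => measurable_cQk ε m)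
    (fun ε y hy => abs_coord_Qk_le ε hy m)
    (fun y hy => continuous_const.mul (continuous_Qk_eps hy)) hh.cb
  refine tendsto_nhds_unique t1 (t2.neg.congr' ?_)
  filter_upwards [self_mem_nhdsWithin] with ε hε
  exact (ibp1 hε hh m).symm

/-- The approximate identity. -/
def Dk (ε : ℝ) (y : E3) : ℝ :=
  ε ^ 2 * Real.exp (-rho ε y) * (1 / rho ε y ^ 3 + 3 / rho ε y ^ 4 + 3 / rho ε y ^ 5)

lemma ibp3 {ε : ℝ} (hε : 0 < ε) {f : E3 → ℝ} (hf : CB2 f) :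
    ∫ y, Gk ε y * (f y - ∑ m, pd m (pd m f) y) = ∫ y, Dk ε y * f y := by
  have j0 := integrable_ker_mul (measurable_Gk ε) (abs_Gk_le' ε) hf.cb.cb
  have j1 : ∀ m, Integrable (fun y => Gk ε y * pd m (pd m f) y) := fun m =>
    integrable_ker_mul (measurable_Gk ε) (abs_Gk_le' ε) ((hf.pd m).pd m)
  have j2 : ∀ m, Integrable (fun y => pd m (pd m (Gk ε)) y * f y) := fun m =>
    integrable_ker_mul (c := 4 + 4 / ε) (measurable_fderiv_apply_const ℝ _ _)
      (fun y hy => abs_pd_pd_Gk_le hε hy m) hf.cb.cb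
  have e : ∀ m, ∫ y, Gk ε y * pd m (pd m f) y = ∫ y, pd m (pd m (Gk ε)) y * f y := fun m => by
    rw [ibp1 hε (hf.pd m), ibp2 hε hf.cb, neg_neg]
  simp only [Dk, ← lap_Gk hε, mul_sub, sub_mul, Finset.mul_sum, Finset.sum_mul]
  rw [integral_sub j0 (integrable_finsetSum _ fun m _ => j1 m),
    integral_sub j0 (integrable_finsetSum _ fun m _ => j2 m),
    integral_finsetSum _ fun m _ => j1 m, integral_finsetSum _ fun m _ => j2 m]
  simp only [e]

lemma rho_smul {ε : ℝ} (hε : 0 < ε) (x : E3) : rho ε (ε • x) = ε * rho 1 x := by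
  unfold rho
  rw [norm_smul, Real.norm_of_nonneg hε.le,
    show (ε * ‖x‖) ^ 2 + ε ^ 2 = ε ^ 2 * (‖x‖ ^ 2 + 1 ^ 2) by ring,
    Real.sqrt_mul (by positivity), Real.sqrt_sq hε.le]

/-- Rescaled approximate identity. -/
def Sk (ε : ℝ) (x : E3) : ℝ :=
  Real.exp (-(ε * rho 1 x)) * (ε ^ 2 / rho 1 x ^ 3 + 3 * ε / rho 1 x ^ 4 + 3 / rho 1 x ^ 5)

lemma scale_Dk {ε : ℝ} (hε : 0 < ε) (f : E3 → ℝ) :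
    ∫ y, Dk ε y * f y = ∫ x, Sk ε x * f (ε • x) := by
  have h := Measure.integral_comp_smul (volume : Measure E3) (fun y => Dk ε y * f y) ε
  have hp : (0 : ℝ) < ε ^ 3 := by positivity
  rw [finrank_E3, abs_of_pos (by positivity), smul_eq_mul] at h
  have h2 : ∫ y, Dk ε y * f y = ε ^ 3 * ∫ x, Dk ε (ε • x) * f (ε • x) := by
    rw [h]; field_simp
  rw [h2, ← integral_const_mul]
  congr 1
  funext x
  have hr := rho_pos one_pos x
  rw [Dk, Sk, rho_smul hε]
  field_simp

lemma Sk_bound {ε : ℝ} (hε : 0 < ε) (x : E3) : |Sk ε x| ≤ 8 * (1 / rho 1 x ^ 5) := by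
  have hr := rho_pos one_pos x
  set r := rho 1 x
  have h1 : Sk ε x = Real.exp (-(ε * r)) * ((ε * r) ^ 2 + 3 * (ε * r) + 3) * (1 / r ^ 5) := by
    change Real.exp (-(ε * r)) * (ε ^ 2 / r ^ 3 + 3 * ε / r ^ 4 + 3 / r ^ 5) = _
    field_simp
  have ht : 0 < ε * r := by positivity
  rw [h1, abs_of_pos (by positivity)]
  gcongr
  rw [Real.exp_neg, inv_mul_le_iff₀ (Real.exp_pos _)]
  have := Real.quadratic_le_exp_of_nonneg ht.le
  nlinarith

lemma L2 {f : E3 → ℝ} (hf : CB2 f) :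
    ∫ y, Gk 0 y * (f y - ∑ m, pd m (pd m f) y) = 4 * Real.pi * f 0 := by
  have t1 := tendsto_ker_mul (k := Gk) measurable_Gk (fun ε y hy => abs_Gk_le ε hy)
    (fun y hy => continuous_Gk_eps hy)
    (hf.cb.cb.sub (CB0.sum fun m => (hf.pd m).pd m))
  obtain ⟨C, hC⟩ := hf.cb.cb.bdd
  have t2 : Filter.Tendsto (fun ε => ∫ x, Sk ε x * f (ε • x)) (nhdsWithin 0 (Ioi 0))
      (nhds (∫ x, Sk 0 x * f ((0 : ℝ) • x))) := by
    refine tendsto_integral_filter_of_dominated_convergence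
      (fun x => C * (8 * (1 / rho 1 x ^ 5))) ?_ ?_ ((integral_sigma5.1.const_mul 8).const_mul C) ?_
    · refine Filter.Eventually.of_forall fun ε => Measurable.aestronglyMeasurable ?_
      have h1 := measurable_rho 1
      have h2 : Measurable fun x : E3 => f (ε • x) := (hf.cb.cb.cont.comp (by fun_prop)).measurable
      unfold Sk
      exact Measurable.mul (by fun_prop) h2
    · filter_upwards [self_mem_nhdsWithin] with ε hε
      refine Filter.Eventually.of_forall fun x => ?_
      rw [Real.norm_eq_abs, abs_mul, mul_comm]
      exact mul_le_mul (hC _) (Sk_bound hε x) (abs_nonneg _) ((abs_nonneg _).trans (hC 0))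
    · refine Filter.Eventually.of_forall fun x => ?_
      have hc : Continuous fun ε : ℝ => Sk ε x * f (ε • x) := by
        have := hf.cb.cb.cont
        unfold Sk
        fun_prop
      exact (hc.tendsto 0).mono_left nhdsWithin_le_nhds
  have e : ∫ x, Sk 0 x * f ((0 : ℝ) • x) = 4 * Real.pi * f 0 := by
    have : ∀ x, Sk 0 x * f ((0 : ℝ) • x) = (3 * f 0) * (1 / rho 1 x ^ 5) := by
      intro x
      simp [Sk]
      ring
    simp only [this]
    rw [integral_const_mul, integral_sigma5.2]
    ring
  rw [← e]
  refine tendsto_nhds_unique t1 (t2.congr' ?_)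
  filter_upwards [self_mem_nhdsWithin] with ε hε
  rw [ibp3 hε hf, scale_Dk hε]



lemma besselM_eq (h : E3 → ℝ) (v : E3) :
    besselM h v = (1 / (4 * Real.pi)) * ∫ y, Gk 0 y * h (v - y) := by
  rw [besselM, ← integral_sub_left_eq_self (fun y => Gk 0 y * h (v - y)) volume v]
  simp [Gk, rho_zero]

lemma integrable_Gk_mul {h : E3 → ℝ} (hh : CB0 h) (v : E3) :
    Integrable (fun y => Gk 0 y * h (v - y)) :=
  integrable_ker_mul (measurable_Gk 0) (abs_Gk_le' 0) (hh.refl v)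

lemma integrable_Gk : Integrable (Gk 0) := by
  simpa using integrable_ker_mul (f := fun _ => 1) (measurable_Gk 0) (abs_Gk_le' 0)
    ⟨continuous_const, 1, fun _ => by simp⟩

lemma CB0.besselM {h : E3 → ℝ} (hh : CB0 h) : CB0 (besselM h) := by
  obtain ⟨C, hC⟩ := hh.bdd
  have hb : ∀ v, ∀ᵐ y : E3, ‖Gk 0 y * h (v - y)‖ ≤ C * Hk y := by
    intro v
    filter_upwards [ae_ne_zero] with y hy
    rw [Real.norm_eq_abs, abs_mul, mul_comm]
    exact mul_le_mul (hC _) (abs_Gk_le 0 hy) (abs_nonneg _) ((abs_nonneg _).trans (hC 0))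
  have e : _root_.besselM h = fun v => (1 / (4 * Real.pi)) * ∫ y, Gk 0 y * h (v - y) :=
    funext (besselM_eq h)
  rw [e]
  refine CB0.const_mul ⟨?_, ∫ y, C * Hk y, fun v => ?_⟩ _
  · refine continuous_of_dominated (fun v => (integrable_Gk_mul hh v).aestronglyMeasurable) hb
      (integrable_Hk.const_mul C) (Filter.Eventually.of_forall fun y => ?_)
    exact continuous_const.mul (hh.cont.comp (by fun_prop))
  · exact norm_integral_le_of_norm_le (integrable_Hk.const_mul C) (hb v)

lemma hasFDerivAt_besselM {h : E3 → ℝ} (hh : CB1 h) (v : E3) :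
    Integrable (fun y => Gk 0 y • fderiv ℝ h (v - y)) ∧
    HasFDerivAt (besselM h)
      ((1 / (4 * Real.pi)) • ∫ y, Gk 0 y • fderiv ℝ h (v - y)) v := by
  choose C hC using fun m => (hh.pd m).bdd
  have hD : ∀ x, ‖fderiv ℝ h x‖ ≤ ∑ m, C m := fun x =>
    (norm_fderiv_le_sum h x).trans (Finset.sum_le_sum fun m _ => hC m x)
  have hb : ∀ y : E3, y ≠ 0 → ∀ v, ‖Gk 0 y • fderiv ℝ h (v - y)‖ ≤ (∑ m, C m) * Hk y := by
    intro y hy v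
    rw [norm_smul, mul_comm]
    exact mul_le_mul (hD _) (abs_Gk_le 0 hy) (abs_nonneg _) ((norm_nonneg _).trans (hD 0))
  have hm : AEStronglyMeasurable (fun y => Gk 0 y • fderiv ℝ h (v - y)) volume := by
    have h1 : Measurable (fun y : E3 => fderiv ℝ h (v - y)) :=
      (measurable_fderiv ℝ h).comp (by fun_prop)
    exact ((measurable_Gk 0).smul h1).aestronglyMeasurable
  have hi : Integrable (fun y => (∑ m, C m) * Hk y) := integrable_Hk.const_mul _
  constructor
  · refine hi.mono' hm ?_
    filter_upwards [ae_ne_zero] with y hy using hb y hy v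
  · have h1 : HasFDerivAt (fun v => ∫ y, Gk 0 y * h (v - y))
        (∫ y, Gk 0 y • fderiv ℝ h (v - y)) v := by
      refine hasFDerivAt_integral_of_dominated_of_fderiv_le (s := univ)
        (F' := fun v y => Gk 0 y • fderiv ℝ h (v - y))
        Filter.univ_mem (Filter.Eventually.of_forall fun v =>
          (integrable_Gk_mul hh.cb v).aestronglyMeasurable) (integrable_Gk_mul hh.cb v) hm
          (bound := fun y => (∑ m, C m) * Hk y) ?_ hi ?_
      · filter_upwards [ae_ne_zero] with y hy x _ using hb y hy x
      · refine Filter.Eventually.of_forall fun y x _ => ?_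
        have h2 : HasFDerivAt (fun x : E3 => h (x - y)) (fderiv ℝ h (x - y)) x := by
          have h3 : HasFDerivAt (fun x : E3 => x - y) (ContinuousLinearMap.id ℝ E3) x :=
            (hasFDerivAt_id x).sub_const y
          have := (hh.diff (x - y)).hasFDerivAt.comp x h3
          rwa [ContinuousLinearMap.comp_id] at this
        exact h2.const_mul _
    have e : besselM h = fun v => (1 / (4 * Real.pi)) * ∫ y, Gk 0 y * h (v - y) :=
      funext (besselM_eq h)
    rw [e]
    exact h1.const_mul _

lemma pd_besselM {h : E3 → ℝ} (hh : CB1 h) (m : Fin 3) :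
    pd m (besselM h) = besselM (pd m h) := by
  funext v
  obtain ⟨hi, hd⟩ := hasFDerivAt_besselM hh v
  rw [pd, hd.fderiv, besselM_eq, ContinuousLinearMap.smul_apply,
    ContinuousLinearMap.integral_apply hi]
  rfl

lemma CB1.besselM {h : E3 → ℝ} (hh : CB1 h) : CB1 (besselM h) :=
  ⟨fun v => (hasFDerivAt_besselM hh v).2.differentiableAt, hh.cb.besselM, fun m => by
    rw [pd_besselM hh]; exact (hh.pd m).besselM⟩

lemma CB2.besselM {h : E3 → ℝ} (hh : CB2 h) : CB2 (besselM h) :=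
  ⟨hh.cb.besselM, fun m => by rw [pd_besselM hh.cb]; exact (hh.pd m).besselM⟩

lemma besselM_inv {f : E3 → ℝ} (hf : CB2 f) (v : E3) :
    besselM (fun x => f x - ∑ m, pd m (pd m f) x) v = f v := by
  rw [besselM_eq]
  have h := L2 (hf.refl v)
  simp only [pd_pd_refl hf v, sub_zero] at h
  rw [h]
  field_simp

lemma besselM_sub {f g : E3 → ℝ} (hf : CB0 f) (hg : CB0 g) (v : E3) :
    besselM (fun x => f x - g x) v = besselM f v - besselM g v := by
  simp only [besselM_eq, mul_sub]
  rw [integral_sub (integrable_Gk_mul hf v) (integrable_Gk_mul hg v), mul_sub]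

lemma besselM_add {f g : E3 → ℝ} (hf : CB0 f) (hg : CB0 g) (v : E3) :
    besselM (fun x => f x + g x) v = besselM f v + besselM g v := by
  simp only [besselM_eq, mul_add]
  rw [integral_add (integrable_Gk_mul hf v) (integrable_Gk_mul hg v), mul_add]

lemma besselM_sum {f : Fin 3 → E3 → ℝ} (hf : ∀ m, CB0 (f m)) (v : E3) :
    besselM (fun x => ∑ m, f m x) v = ∑ m, besselM (f m) v := by
  simp only [Fin.sum_univ_three]
  rw [besselM_add ((hf 0).add (hf 1)) (hf 2), besselM_add (hf 0) (hf 1)]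

lemma lap_besselM {h : E3 → ℝ} (hh : CB2 h) (v : E3) :
    ∑ m, pd m (pd m (besselM h)) v = besselM h v - h v := by
  have h1 := besselM_inv hh v
  rw [besselM_sub hh.cb.cb (CB0.sum fun m => (hh.pd m).pd m),
    besselM_sum fun m => (hh.pd m).pd m] at h1
  have h2 : ∀ m, pd m (pd m (besselM h)) v = besselM (pd m (pd m h)) v := fun m => by
    rw [pd_besselM hh.cb, pd_besselM (hh.pd m)]
  simp only [h2]
  linarith

lemma integrable_besselM {h : E3 → ℝ} (hi : Integrable h) : Integrable (besselM h) := by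
  have h1 := (integrable_Gk.integrable_convolution (ContinuousLinearMap.mul ℝ ℝ) hi).const_mul
    (1 / (4 * Real.pi))
  refine h1.congr (Filter.Eventually.of_forall fun v => ?_)
  rw [besselM_eq]
  rfl

lemma besselM_pd {h : E3 → ℝ} (hh : CB1 h) (m : Fin 3) (v : E3) :
    besselM (pd m h) v = (1 / (4 * Real.pi)) * ∫ y, (y m * Qk 0 y) * h (v - y) := by
  have h1 := L1 (hh.refl v) m
  rw [pd_refl hh.diff] at h1
  simp only [mul_neg, integral_neg, neg_inj] at h1
  rw [besselM_eq, h1]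

/-- Pointwise bounds for the singular kernels. -/
lemma inv_norm_le (y : E3) : 1 / ‖y‖ ≤ Real.exp 1 * Hk y + 1 ∧
    1 / ‖y‖ ^ 2 ≤ Real.exp 1 * Hk y + 1 := by
  rcases eq_or_ne y 0 with rfl | hy
  · simp [Hk]
  have h0 : 0 < ‖y‖ := norm_pos_iff.2 hy
  have hH := Hk_nonneg y
  have p1 : 0 < 1 / ‖y‖ := by positivity
  have p2 : 0 < 1 / ‖y‖ ^ 2 := by positivity
  rcases le_or_gt ‖y‖ 1 with h | h
  · have h2 : 1 ≤ Real.exp 1 * Real.exp (-‖y‖) := by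
      rw [← Real.exp_add]
      exact Real.one_le_exp (by linarith)
    have h3 : 1 / ‖y‖ + 1 / ‖y‖ ^ 2 ≤ Real.exp 1 * Hk y := by
      rw [Hk, ← mul_assoc]
      exact le_mul_of_one_le_left (by positivity) h2
    constructor <;> linarith
  · have h2 : 1 / ‖y‖ ≤ 1 := by rw [div_le_one h0]; exact h.le
    have h3 : 1 / ‖y‖ ^ 2 ≤ 1 := by rw [div_le_one (by positivity)]; nlinarith
    have : 0 ≤ Real.exp 1 * Hk y := by positivity
    constructor <;> linarith

lemma abs_Pker_le (z : E3) (i j : Fin 3) : |Pker z i j| ≤ 2 := by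
  unfold Pker
  have h1 : |(if i = j then (1 : ℝ) else 0)| ≤ 1 := by split_ifs <;> simp
  have h2 : |z i * z j / ‖z‖ ^ 2| ≤ 1 := by
    rw [abs_div, abs_mul, abs_of_nonneg (sq_nonneg ‖z‖)]
    apply div_le_one_of_le₀ _ (by positivity)
    rw [sq]
    exact mul_le_mul (abs_coord_le z i) (abs_coord_le z j) (abs_nonneg _) (norm_nonneg _)
  exact (abs_sub _ _).trans (by linarith)

lemma measurable_Kk (v : E3) (i j : Fin 3) :
    Measurable (fun z : E3 => Pker (v - z) i j / ‖v - z‖) := by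
  unfold Pker; fun_prop

lemma abs_Kk_le (v z : E3) (i j : Fin 3) :
    |Pker (v - z) i j / ‖v - z‖| ≤ 2 * (1 / ‖v - z‖) := by
  rw [abs_div, abs_norm, div_eq_mul_one_div]
  gcongr
  exact abs_Pker_le _ i j

lemma integrable_Kk {f : E3 → ℝ} (hf : CB0 f) (hi : Integrable f) (v : E3) (i j : Fin 3) :
    Integrable (fun z => Pker (v - z) i j / ‖v - z‖ * f z) := by
  obtain ⟨C, hC⟩ := hf.bdd
  have h1 : Integrable (fun z => Hk (v - z)) := integrable_Hk.comp_sub_left v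
  refine ((h1.const_mul (2 * Real.exp 1 * C)).add (hi.abs.const_mul 2)).mono'
    ((measurable_Kk v i j).mul hf.cont.measurable).aestronglyMeasurable
    (Filter.Eventually.of_forall fun z => ?_)
  rw [Real.norm_eq_abs, abs_mul]
  have h2 := (inv_norm_le (v - z)).1
  have h3 := abs_Kk_le v z i j
  have hH := Hk_nonneg (v - z)
  calc _ ≤ (2 * (Real.exp 1 * Hk (v - z) + 1)) * |f z| := by
        gcongr
        exact h3.trans (by linarith)
    _ = 2 * Real.exp 1 * Hk (v - z) * |f z| + 2 * |f z| := by ring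
    _ ≤ 2 * Real.exp 1 * Hk (v - z) * C + 2 * |f z| := by
        gcongr
        exact hC z
    _ = _ := by simp only [Pi.add_apply]; ring

lemma landau_identity (w : SchwartzMap E3 ℝ) (v : E3) (i j : Fin 3) :
    LandauA (⇑w) v i j = LandauA (besselM ⇑w) v i j
      - LandauA (fun u => ∑ m, pd m (pd m (besselM ⇑w)) u) v i j := by
  have hw := CB2.schwartz w
  have i1 := integrable_Kk hw.cb.cb w.integrable v i j
  have i2 := integrable_Kk hw.cb.cb.besselM (integrable_besselM w.integrable) v i j
  simp only [LandauA, lap_besselM hw, mul_sub]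
  rw [integral_sub i2 i1]
  ring



/-- The inverse squared Japanese bracket. -/
def phi (y : E3) : ℝ := (1 + ‖y‖ ^ 2)⁻¹

lemma phi_pos (y : E3) : 0 < phi y := by unfold phi; positivity

lemma phi_mul (y : E3) : phi y * (1 + ‖y‖ ^ 2) = 1 := by
  unfold phi; exact inv_mul_cancel₀ (by positivity)

lemma phi_le_one (y : E3) : phi y ≤ 1 := by
  unfold phi; exact inv_le_one_of_one_le₀ (by nlinarith [sq_nonneg ‖y‖])

lemma hasFDerivAt_phi (y : E3) : HasFDerivAt phi ((-2 * phi y ^ 2) • innerSL ℝ y) y := by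
  have h1 : HasFDerivAt (fun x : E3 => 1 + ‖x‖ ^ 2) (2 • innerSL ℝ y) y :=
    (hasStrictFDerivAt_norm_sq y).hasFDerivAt.const_add 1
  have hd : HasDerivAt (fun t : ℝ => t⁻¹) (-((1 + ‖y‖ ^ 2) ^ 2)⁻¹) (1 + ‖y‖ ^ 2) :=
    hasDerivAt_inv (by positivity)
  have h2 := hd.comp_hasFDerivAt y h1
  refine HasFDerivAt.congr_fderiv (f := phi) h2 ?_
  ext x
  simp [phi]
  ring

lemma diff_phi : Differentiable ℝ phi := fun y => (hasFDerivAt_phi y).differentiableAt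

lemma pd_phi (m : Fin 3) : pd m phi = fun y => y m * (-2 * (phi y * phi y)) := by
  funext y
  rw [pd_of_hasFDerivAt (hasFDerivAt_phi y)]
  ring

lemma abs_pd_phi_le (m : Fin 3) (y : E3) : |pd m phi y| ≤ phi y := by
  rw [pd_phi]
  have h1 := abs_coord_le y m
  have h2 := phi_mul y
  have h3 := phi_pos y
  have h4 : 2 * |y m| ≤ 1 + ‖y‖ ^ 2 := by nlinarith [sq_nonneg (‖y‖ - 1)]
  have h5 : |y m * (-2 * (phi y * phi y))| = (2 * |y m| * phi y) * phi y := by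
    rw [abs_mul, abs_mul, abs_of_pos (mul_pos h3 h3)]; norm_num; ring
  simp only [h5]
  have h6 : 2 * |y m| * phi y ≤ 1 := by nlinarith
  nlinarith

lemma CB0_phi : CB0 phi :=
  ⟨diff_phi.continuous, 1, fun y => by rw [abs_of_pos (phi_pos y)]; exact phi_le_one y⟩

lemma cont_pd_phi (m : Fin 3) : Continuous (pd m phi) := by
  rw [pd_phi]
  have := diff_phi.continuous
  fun_prop

lemma CB1_phi : CB1 phi :=
  ⟨diff_phi, CB0_phi, fun m => ⟨cont_pd_phi m, 1, fun y => (abs_pd_phi_le m y).trans (phi_le_one y)⟩⟩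

lemma pd_coord' (n m : Fin 3) : pd n (fun y : E3 => y m) = fun _ => if n = m then 1 else 0 := by
  funext x
  have h : HasFDerivAt (fun y : E3 => y m) (EuclideanSpace.proj m : E3 →L[ℝ] ℝ) x :=
    (EuclideanSpace.proj m : E3 →L[ℝ] ℝ).hasFDerivAt
  rw [pd, h.fderiv]
  simp [Pi.single_apply, eq_comm]

lemma diff_psi : Differentiable ℝ (fun y => -2 * (phi y * phi y)) :=
  (diff_phi.fun_mul diff_phi).const_mul _

lemma pd_pd_phi (n m : Fin 3) : pd n (pd m phi) = fun y =>
    y m * (8 * (y n * phi y ^ 3)) + (-2 * (phi y * phi y)) * (if n = m then 1 else 0) := by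
  rw [pd_phi, pd_mul (diff_coord m) diff_psi, pd_coord']
  have h : pd n (fun y => -2 * (phi y * phi y)) = fun y => 8 * (y n * phi y ^ 3) := by
    rw [pd_mul (differentiable_const _) (diff_phi.fun_mul diff_phi), pd_mul diff_phi diff_phi, pd_phi]
    funext y
    simp [pd]
    ring
  rw [h]

lemma abs_pd_pd_phi_le (n m : Fin 3) (y : E3) : |pd n (pd m phi) y| ≤ 10 * phi y := by
  rw [pd_pd_phi]
  have h1 := abs_coord_le y m
  have h1' := abs_coord_le y n
  have h2 := phi_mul y
  have h3 := phi_pos y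
  have h4 := phi_le_one y
  refine (abs_add_le _ _).trans ?_
  have h5 : |y m * (8 * (y n * phi y ^ 3))| ≤ 8 * phi y := by
    rw [abs_mul, abs_mul, abs_mul, abs_of_pos (pow_pos h3 3), abs_of_pos (by norm_num : (0:ℝ) < 8)]
    have h6 : |y m| * |y n| ≤ ‖y‖ ^ 2 := by
      rw [sq]; exact mul_le_mul h1 h1' (abs_nonneg _) (norm_nonneg _)
    have h7 : |y m| * |y n| * phi y ≤ 1 := by nlinarith
    have h8 : phi y ^ 2 ≤ phi y := by nlinarith
    calc _ = 8 * ((|y m| * |y n| * phi y) * phi y ^ 2) := by ring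
      _ ≤ 8 * (1 * phi y) := by gcongr
      _ = _ := by ring
  have h6 : |(-2 * (phi y * phi y)) * (if n = m then 1 else 0)| ≤ 2 * phi y := by
    split_ifs
    · rw [abs_mul, abs_mul, abs_of_pos (mul_pos h3 h3)]; norm_num; nlinarith
    · simp [h3.le]
  linarith

lemma CB2_phi : CB2 phi := by
  refine ⟨CB1_phi, fun m => ⟨?_, CB1_phi.pd m, fun n => ⟨?_, 10, fun y => ?_⟩⟩⟩
  · rw [pd_phi]; exact (diff_coord m).fun_mul diff_psi
  · rw [pd_pd_phi]
    have := diff_phi.continuous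
    fun_prop
  · exact (abs_pd_pd_phi_le n m y).trans (by nlinarith [phi_le_one y])

/-- Multiplying a Schwartz function by the squared bracket. -/
lemma exists_weighted (w : SchwartzMap E3 ℝ) :
    ∃ W : SchwartzMap E3 ℝ, (W : E3 → ℝ) = fun u => jap u ^ 2 * w u := by
  have hg : Function.HasTemperateGrowth (fun u : E3 => 1 + ‖u‖ ^ 2) := by fun_prop
  refine ⟨SchwartzMap.smulLeftCLM ℝ (fun u : E3 => 1 + ‖u‖ ^ 2) w, ?_⟩
  funext u
  rw [SchwartzMap.smulLeftCLM_apply_apply hg, jap, Real.sq_sqrt (by positivity), smul_eq_mul]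

lemma besselM_decomp (w W : SchwartzMap E3 ℝ) (hW : (W : E3 → ℝ) = fun u => jap u ^ 2 * w u)
    (z : E3) : besselM w z = phi z * besselM W z
      + ∑ m, (besselM (pd m (fun x => besselM W x * pd m phi x)) z
        + besselM (pd m (fun x => besselM W x * pd m phi x)) z
        - besselM (fun x => besselM W x * pd m (pd m phi) x) z) := by
  have hg : CB2 (besselM W) := (CB2.schwartz W).besselM
  have hf : CB2 (fun x => phi x * besselM W x) := CB2_phi.mul hg
  have hh : ∀ m, CB1 (fun x => besselM W x * pd m phi x) := fun m => hg.cb.mul (CB2_phi.pd m)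
  have hk : ∀ m, CB0 (fun x => besselM W x * pd m (pd m phi) x) :=
    fun m => hg.cb.cb.mul ((CB2_phi.pd m).pd m)
  have key : (w : E3 → ℝ) = fun x => ((phi x * besselM W x) -
      ∑ m, pd m (pd m (fun x => phi x * besselM W x)) x) +
      ∑ m, (pd m (fun x => besselM W x * pd m phi x) x + pd m (fun x => besselM W x * pd m phi x) x
        - besselM W x * pd m (pd m phi) x) := by
    funext x
    have h1 := lap_besselM (CB2.schwartz W) x
    have h2 : w x = phi x * W x := by
      rw [hW]
      simp only [jap]
      rw [Real.sq_sqrt (by positivity), ← mul_assoc, phi_mul, one_mul]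
    have h3 : W x = besselM W x - ∑ m, pd m (pd m (besselM W)) x := by linarith
    rw [h2, h3]
    simp only [pd_pd_mul CB2_phi hg, pd_mul hg.cb.diff (CB2_phi.pd _).diff, Fin.sum_univ_three]
    ring
  have hs : ∀ m, CB0 (fun x => pd m (fun x => besselM W x * pd m phi x) x
      + pd m (fun x => besselM W x * pd m phi x) x - besselM W x * pd m (pd m phi) x) := fun m =>
    (((hh m).pd m).add ((hh m).pd m)).sub (hk m)
  conv_lhs => rw [key]
  rw [besselM_add (hf.cb.cb.sub (CB0.sum fun m => (hf.pd m).pd m)) (CB0.sum hs),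
    besselM_inv hf, besselM_sum hs]
  congr 1
  refine Finset.sum_congr rfl fun m _ => ?_
  rw [besselM_sub (((hh m).pd m).add ((hh m).pd m)) (hk m), besselM_add ((hh m).pd m) ((hh m).pd m)]

lemma inv_four_pi_le : (1 / (4 * Real.pi)) ≤ 1 := by
  rw [div_le_one (by positivity)]; linarith [Real.pi_gt_three]

lemma ker_bound {k u f : E3 → ℝ} {c : ℝ} (hc : 0 ≤ c) (hk : ∀ y, y ≠ 0 → |k y| ≤ Hk y)
    (hf : CB0 f) (hu : ∀ x, |u x| ≤ c * |f x|) (z : E3) :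
    |(1 / (4 * Real.pi)) * ∫ y, k y * u (z - y)| ≤ c * ∫ y, Hk y * |f (z - y)| := by
  have hi : Integrable (fun y => Hk y * |f (z - y)|) := by
    have hfz := hf.refl z
    refine integrable_ker_mul (c := 1) measurable_Hk (fun y _ => ?_)
      (f := fun y => |f (z - y)|) ⟨hfz.cont.abs, ?_⟩
    · rw [abs_of_nonneg (Hk_nonneg y), one_mul]
    · obtain ⟨C, hC⟩ := hfz.bdd
      exact ⟨C, fun x => by rw [abs_abs]; exact hC x⟩
  have h1 : ‖∫ y, k y * u (z - y)‖ ≤ ∫ y, c * (Hk y * |f (z - y)|) := by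
    refine norm_integral_le_of_norm_le (hi.const_mul c) ?_
    filter_upwards [ae_ne_zero] with y hy
    rw [norm_mul, Real.norm_eq_abs, Real.norm_eq_abs]
    calc |k y| * |u (z - y)| ≤ Hk y * (c * |f (z - y)|) :=
          mul_le_mul (hk y hy) (hu _) (abs_nonneg _) (Hk_nonneg y)
      _ = _ := by ring
  rw [integral_const_mul, Real.norm_eq_abs] at h1
  rw [abs_mul, abs_of_pos (by positivity : 0 < 1 / (4 * Real.pi))]
  calc _ ≤ 1 * |∫ y, k y * u (z - y)| := by gcongr; exact inv_four_pi_le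
    _ ≤ _ := by rw [one_mul]; exact h1

lemma besselM_bound (w W : SchwartzMap E3 ℝ) (hW : (W : E3 → ℝ) = fun u => jap u ^ 2 * w u)
    (z : E3) : |besselM w z| ≤ |phi z * besselM W z|
      + 36 * ∫ y, Hk y * |phi (z - y) * besselM W (z - y)| := by
  have hg : CB2 (besselM W) := (CB2.schwartz W).besselM
  have hf : CB0 (fun x => phi x * besselM W x) := (CB2_phi.mul hg).cb.cb
  have hh : ∀ m, CB1 (fun x => besselM W x * pd m phi x) := fun m => hg.cb.mul (CB2_phi.pd m)
  have b1 : ∀ m, |besselM (pd m (fun x => besselM W x * pd m phi x)) z| ≤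
      1 * ∫ y, Hk y * |phi (z - y) * besselM W (z - y)| := fun m => by
    rw [besselM_pd (hh m)]
    refine ker_bound (k := fun y => y m * Qk 0 y) (u := fun x => besselM W x * pd m phi x)
      zero_le_one (fun y hy => abs_coord_Qk_le 0 hy m) hf (fun x => ?_) z
    rw [one_mul, abs_mul, abs_mul, mul_comm, abs_of_pos (phi_pos x)]
    exact mul_le_mul_of_nonneg_right (abs_pd_phi_le m x) (abs_nonneg _)
  have b2 : ∀ m, |besselM (fun x => besselM W x * pd m (pd m phi) x) z| ≤
      10 * ∫ y, Hk y * |phi (z - y) * besselM W (z - y)| := fun m => by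
    rw [besselM_eq]
    refine ker_bound (k := Gk 0) (u := fun x => besselM W x * pd m (pd m phi) x)
      (by norm_num) (fun y hy => abs_Gk_le 0 hy) hf (fun x => ?_) z
    rw [abs_mul, abs_mul, mul_comm, abs_of_pos (phi_pos x), ← mul_assoc]
    exact mul_le_mul_of_nonneg_right (abs_pd_pd_phi_le m m x) (abs_nonneg _)
  rw [besselM_decomp w W hW z]
  refine (abs_add_le _ _).trans (add_le_add le_rfl ?_)
  refine (Finset.abs_sum_le_sum_abs _ _).trans ?_
  set I := ∫ y, Hk y * |phi (z - y) * besselM W (z - y)|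
  have : ∀ m, |besselM (pd m (fun x => besselM W x * pd m phi x)) z
        + besselM (pd m (fun x => besselM W x * pd m phi x)) z
        - besselM (fun x => besselM W x * pd m (pd m phi) x) z| ≤ 12 * I := fun m => by
    have h1 := b1 m
    have h2 := b2 m
    rw [abs_le] at h1 h2 ⊢
    constructor <;> linarith [h1.1, h1.2, h2.1, h2.2]
  refine (Finset.sum_le_sum fun m _ => this m).trans ?_
  simp
  linarith



lemma integrable_phi_sq : Integrable (fun x => phi x ^ 2) := by
  have h := integrable_rpow_neg_one_add_norm_sq (E := E3) (μ := volume) (r := 4)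
    (by rw [finrank_E3]; norm_num)
  refine h.congr (Filter.Eventually.of_forall fun x => ?_)
  simp only [phi]
  rw [show (-4 / 2 : ℝ) = -((2 : ℕ) : ℝ) by norm_num, Real.rpow_neg (by positivity),
    Real.rpow_natCast, inv_pow]

/-- The constant of the weighted Hardy type estimate. -/
def Mc : ℝ≥0∞ := (∫⁻ x, ENNReal.ofReal (Real.exp 1 * Hk x)) + ∫⁻ x, ENNReal.ofReal (phi x ^ 2)

lemma Mc_lt_top : Mc < ⊤ := by
  unfold Mc
  exact ENNReal.add_lt_top.2 ⟨(integrable_Hk.const_mul _).lintegral_lt_top,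
    integrable_phi_sq.lintegral_lt_top⟩

lemma measurable_phi : Measurable phi := diff_phi.continuous.measurable

lemma hardy (v : E3) :
    ∫⁻ x, (ENNReal.ofReal (1 / ‖v - x‖) * ENNReal.ofReal (phi x)) ^ (2 : ℝ) ≤ Mc := by
  have h0 : ∫⁻ x, ENNReal.ofReal (Real.exp 1 * Hk x) =
      ∫⁻ x, ENNReal.ofReal (Real.exp 1 * Hk (v - x)) :=
    (lintegral_sub_left_eq_self (fun x => ENNReal.ofReal (Real.exp 1 * Hk x)) v).symm
  have hm : Measurable (fun x : E3 => ENNReal.ofReal (phi x ^ 2)) :=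
    (measurable_phi.pow_const 2).ennreal_ofReal
  rw [Mc, h0, ← lintegral_add_right _ hm]
  refine lintegral_mono fun x => ?_
  have p1 := phi_pos x
  have p2 := phi_le_one x
  have p3 := Hk_nonneg (v - x)
  have h1 := (inv_norm_le (v - x)).2
  rw [← ENNReal.ofReal_mul (by positivity), ENNReal.ofReal_rpow_of_nonneg (by positivity) (by norm_num),
    ← ENNReal.ofReal_add (by positivity) (by positivity)]
  apply ENNReal.ofReal_le_ofReal
  rw [Real.rpow_two, mul_pow, div_pow, one_pow]
  have p4 : phi x ^ 2 ≤ 1 := by nlinarith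
  calc 1 / ‖v - x‖ ^ 2 * phi x ^ 2 ≤ (Real.exp 1 * Hk (v - x) + 1) * phi x ^ 2 := by gcongr
    _ = (Real.exp 1 * Hk (v - x)) * phi x ^ 2 + phi x ^ 2 := by ring
    _ ≤ (Real.exp 1 * Hk (v - x)) * 1 + phi x ^ 2 := by gcongr
    _ = _ := by ring

lemma cs_bound {g : E3 → ℝ} (hg : Continuous g) (v : E3) :
    ∫⁻ x, ENNReal.ofReal (1 / ‖v - x‖) * ‖phi x * g x‖ₑ ≤
      Mc ^ (1 / 2 : ℝ) * eLpNorm g 2 volume := by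
  have h1 : ∀ x, ENNReal.ofReal (1 / ‖v - x‖) * ‖phi x * g x‖ₑ =
      (ENNReal.ofReal (1 / ‖v - x‖) * ENNReal.ofReal (phi x)) * ‖g x‖ₑ := fun x => by
    rw [enorm_mul, Real.enorm_of_nonneg (phi_pos x).le, mul_assoc]
  simp only [h1]
  have hm := measurable_phi
  have hgm := hg.measurable
  have h2 := ENNReal.lintegral_mul_le_Lp_mul_Lq volume (Real.HolderConjugate.two_two)
    (f := fun x => ENNReal.ofReal (1 / ‖v - x‖) * ENNReal.ofReal (phi x)) (g := fun x => ‖g x‖ₑ)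
    (by fun_prop) (by fun_prop)
  refine h2.trans ?_
  rw [eLpNorm_eq_lintegral_rpow_enorm_toReal (by norm_num) (by norm_num)]
  simp only [ENNReal.toReal_ofNat]
  gcongr
  exact hardy v

lemma conv_bound {g : E3 → ℝ} (hg : Continuous g) (v : E3) :
    ∫⁻ z, ENNReal.ofReal (1 / ‖v - z‖) *
        (∫⁻ y, ENNReal.ofReal (Hk y) * ‖phi (z - y) * g (z - y)‖ₑ) ≤
      (∫⁻ y, ENNReal.ofReal (Hk y)) * (Mc ^ (1 / 2 : ℝ) * eLpNorm g 2 volume) := by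
  have hm := measurable_phi
  have hgm := hg.measurable
  have hH := measurable_Hk
  have e1 : ∀ z, ENNReal.ofReal (1 / ‖v - z‖) *
        (∫⁻ y, ENNReal.ofReal (Hk y) * ‖phi (z - y) * g (z - y)‖ₑ) =
      ∫⁻ y, ENNReal.ofReal (1 / ‖v - z‖) * (ENNReal.ofReal (Hk y) * ‖phi (z - y) * g (z - y)‖ₑ) :=
    fun z => (lintegral_const_mul _ (by fun_prop)).symm
  simp only [e1]
  rw [lintegral_lintegral_swap]
  swap
  · apply Measurable.aemeasurable
    unfold Function.uncurry
    fun_prop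
  rw [← lintegral_mul_const _ (by fun_prop)]
  refine lintegral_mono fun y => ?_
  have e2 : ∀ z, ENNReal.ofReal (1 / ‖v - z‖) *
      (ENNReal.ofReal (Hk y) * ‖phi (z - y) * g (z - y)‖ₑ) =
      ENNReal.ofReal (Hk y) * (ENNReal.ofReal (1 / ‖v - z‖) * ‖phi (z - y) * g (z - y)‖ₑ) :=
    fun z => by ring
  simp only [e2]
  rw [lintegral_const_mul _ (by fun_prop)]
  gcongr
  rw [← lintegral_add_right_eq_self _ y]
  refine le_trans (le_of_eq ?_) (cs_bound hg (v - y))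
  refine lintegral_congr fun x => ?_
  rw [add_sub_cancel_right, show v - (x + y) = v - y - x by abel]

lemma enorm_besselM_le (w W : SchwartzMap E3 ℝ)
    (hW : (W : E3 → ℝ) = fun u => jap u ^ 2 * w u) (z : E3) :
    ‖besselM w z‖ₑ ≤ ‖phi z * besselM W z‖ₑ +
      36 * ∫⁻ y, ENNReal.ofReal (Hk y) * ‖phi (z - y) * besselM W (z - y)‖ₑ := by
  have h := ENNReal.ofReal_le_ofReal (besselM_bound w W hW z)
  rw [← Real.enorm_eq_ofReal_abs] at h
  refine h.trans (ENNReal.ofReal_add_le.trans ?_)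
  rw [← Real.enorm_eq_ofReal_abs, ENNReal.ofReal_mul (by norm_num), ENNReal.ofReal_ofNat]
  gcongr
  refine (Real.ofReal_le_enorm _).trans ((enorm_integral_le_lintegral_enorm _).trans ?_)
  refine lintegral_mono fun y => ?_
  rw [enorm_mul, Real.enorm_of_nonneg (abs_nonneg _), ← Real.enorm_eq_ofReal_abs,
    Real.enorm_of_nonneg (Hk_nonneg y)]

/-- The constant for one entry. -/
def Cc : ℝ≥0∞ := (1 + 36 * ∫⁻ y, ENNReal.ofReal (Hk y)) * Mc ^ (1 / 2 : ℝ)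

lemma Cc_lt_top : Cc < ⊤ := by
  unfold Cc
  refine ENNReal.mul_lt_top (ENNReal.add_lt_top.2 ⟨ENNReal.one_lt_top,
    ENNReal.mul_lt_top (by simp) integrable_Hk.lintegral_lt_top⟩) ?_
  exact ENNReal.rpow_lt_top_of_nonneg (by norm_num) Mc_lt_top.ne

lemma entry_bound (w W : SchwartzMap E3 ℝ)
    (hW : (W : E3 → ℝ) = fun u => jap u ^ 2 * w u) (v : E3) (i j : Fin 3) :
    ENNReal.ofReal |LandauA (besselM w) v i j| ≤ Cc * eLpNorm (besselM W) 2 volume := by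
  have hg : CB0 (besselM W) := (CB0.schwartz W).besselM
  have hgm := hg.cont.measurable
  have hm := measurable_phi
  have hH := measurable_Hk
  rw [← Real.enorm_eq_ofReal_abs, LandauA, ← integral_const_mul]
  refine (enorm_integral_le_lintegral_enorm _).trans ?_
  have hp : ∀ z, ‖1 / (8 * Real.pi) * (Pker (v - z) i j / ‖v - z‖ * besselM w z)‖ₑ ≤
      ENNReal.ofReal (1 / ‖v - z‖) * ‖phi z * besselM W z‖ₑ + 36 * (ENNReal.ofReal (1 / ‖v - z‖) *
      ∫⁻ y, ENNReal.ofReal (Hk y) * ‖phi (z - y) * besselM W (z - y)‖ₑ) := fun z => by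
    have h1 : ‖1 / (8 * Real.pi) * (Pker (v - z) i j / ‖v - z‖)‖ₑ ≤
        ENNReal.ofReal (1 / ‖v - z‖) := by
      rw [Real.enorm_eq_ofReal_abs]
      apply ENNReal.ofReal_le_ofReal
      rw [abs_mul, abs_of_pos (by positivity : 0 < 1 / (8 * Real.pi))]
      have h2 := abs_Kk_le v z i j
      have h3 : 1 / (8 * Real.pi) ≤ 1 / 2 := by
        apply one_div_le_one_div_of_le <;> linarith [Real.pi_gt_three]
      calc _ ≤ 1 / 2 * (2 * (1 / ‖v - z‖)) := by gcongr
        _ = _ := by ring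
    rw [← mul_assoc, enorm_mul]
    calc _ ≤ ENNReal.ofReal (1 / ‖v - z‖) * _ :=
          mul_le_mul' h1 (enorm_besselM_le w W hW z)
      _ = _ := by ring
  refine (lintegral_mono hp).trans ?_
  rw [lintegral_add_left (by fun_prop), lintegral_const_mul' _ _ (by simp)]
  calc _ ≤ Mc ^ (1 / 2 : ℝ) * eLpNorm (besselM W) 2 volume + 36 *
        ((∫⁻ y, ENNReal.ofReal (Hk y)) * (Mc ^ (1 / 2 : ℝ) * eLpNorm (besselM W) 2 volume)) := by
        gcongr
        · exact cs_bound hg.cont v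
        · exact conv_bound hg.cont v
    _ = _ := by unfold Cc; ring

lemma one_le_jap (v : E3) : 1 ≤ jap v := by
  unfold jap
  rw [Real.one_le_sqrt]
  nlinarith [sq_nonneg ‖v‖]

lemma matrix_bound (w : SchwartzMap E3 ℝ) (v : E3) :
    ENNReal.ofReal (∑ i, ∑ j, |LandauA (besselM ⇑w) v i j|)
      ≤ ENNReal.ofReal ((9 * Cc.toReal + 1) * jap v) *
        eLpNorm (besselM fun u => jap u ^ 2 * w u) 2 volume := by
  obtain ⟨W, hW⟩ := exists_weighted w
  rw [← hW]
  rw [ENNReal.ofReal_sum_of_nonneg fun i _ => Finset.sum_nonneg fun j _ => abs_nonneg _]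
  have h1 : ∀ i, ENNReal.ofReal (∑ j, |LandauA (besselM ⇑w) v i j|) ≤
      ∑ j : Fin 3, Cc * eLpNorm (besselM W) 2 volume := fun i => by
    rw [ENNReal.ofReal_sum_of_nonneg fun j _ => abs_nonneg _]
    exact Finset.sum_le_sum fun j _ => entry_bound w W hW v i j
  refine (Finset.sum_le_sum fun i _ => h1 i).trans ?_
  simp only [Finset.sum_const, Finset.card_univ, Fintype.card_fin, nsmul_eq_mul]
  rw [← mul_assoc, ← mul_assoc]
  gcongr
  have h2 : ((3 : ℕ) : ℝ≥0∞) * ((3 : ℕ) : ℝ≥0∞) * Cc = ENNReal.ofReal (9 * Cc.toReal) := by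
    rw [ENNReal.ofReal_mul (by norm_num), ENNReal.ofReal_toReal Cc_lt_top.ne]
    norm_num
  rw [h2]
  apply ENNReal.ofReal_le_ofReal
  have h3 := one_le_jap v
  have h4 : 0 ≤ Cc.toReal := ENNReal.toReal_nonneg
  nlinarith


/-- Proposition 3.1, identity (3.5) and bound (3.6): for Schwartz `w₀` and `w = ⟨·⟩²w₀`,
`A[w₀] = A[𝓜w₀] − A[Δ(𝓜w₀)]`, and `|A[𝓜w₀](v)| ≤ C ⟨v⟩ ‖𝓜w‖_{L²}` with a universal `C`. -/
theorem landau_matrix_bessel_decomposition :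
    ∃ C > 0, ∀ w₀ : SchwartzMap (EuclideanSpace ℝ (Fin 3)) ℝ,
      (∀ v : EuclideanSpace ℝ (Fin 3), ∀ i j : Fin 3,
        LandauA (⇑w₀) v i j
          = LandauA (besselM ⇑w₀) v i j
            - LandauA (fun u => ∑ m, pd m (pd m (besselM ⇑w₀)) u) v i j) ∧
      ∀ v : EuclideanSpace ℝ (Fin 3),
        ENNReal.ofReal (∑ i, ∑ j, |LandauA (besselM ⇑w₀) v i j|)
          ≤ ENNReal.ofReal (C * jap v) *
              eLpNorm (besselM fun u => jap u ^ 2 * w₀ u) 2 volume := by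
  refine ⟨9 * Cc.toReal + 1, ?_, fun w₀ => ⟨fun v i j => landau_identity w₀ v i j,
    fun v => matrix_bound w₀ v⟩⟩
  have : 0 ≤ Cc.toReal := ENNReal.toReal_nonneg
  linarith
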